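/- arXiv:1701.03632 — 4 statements merged into one kernel-verified Lean document; each statement's English description precedes it below -/
import Mathlib

section
/- If G is a tree (a connected acyclic graph) on vertex set V with edge set E, then the maximum of det(M) over M ∈ Ψ(G,x) equals (1-x²)^{|E|}; i.e., τ(G,x) = (1-x²)^{|E(G)|} for all x ∈ (-1,1). -/
def Psi {V : Type*} [Fintype V] (G : SimpleGraph V) (x : ℝ) : Set (Matrix V V ℝ) :=
  {M | M.PosDef ∧ (∀ i, M i i = 1) ∧ ∀ i j, G.Adj i j → M i j = x}

open Matrix in
theorem aux_upper {m : Type*} [Fintype m] [DecidableEq m] (A : Matrix m m ℝ)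
    (b : m → ℝ) (hA : A.PosDef) (w : m) (x : ℝ) (hw : A w w = 1) (hb : b w = x) :
    (Matrix.fromBlocks A (replicateCol Unit b) (replicateRow Unit b) 1).det
      ≤ A.det * (1 - x ^ 2) := by
  have hu : IsUnit A.det := (Matrix.isUnit_iff_isUnit_det A).1 hA.isUnit
  have : Invertible A := hA.isUnit.invertible
  rw [Matrix.det_fromBlocks₁₁]
  refine mul_le_mul_of_nonneg_left ?_ hA.det_pos.le
  rw [Matrix.det_unique, Matrix.invOf_eq_nonsing_inv]
  have h1 : (1 - replicateRow Unit b * A⁻¹ * replicateCol Unit b : Matrix Unit Unit ℝ) default default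
      = 1 - b ⬝ᵥ (A⁻¹ *ᵥ b) := by
    rw [Matrix.mul_assoc]
    simp [Matrix.mul_apply, dotProduct, mulVec]
  rw [h1]
  have h2 := hA.posSemidef.dotProduct_mulVec_nonneg (A⁻¹ *ᵥ b - x • Pi.single w 1)
  have hs : Aᵀ = A := by simpa using hA.isHermitian.eq
  have h3 : A *ᵥ (A⁻¹ *ᵥ b) = b := by
    rw [mulVec_mulVec, Matrix.mul_nonsing_inv _ hu, one_mulVec]
  have h4 : (A⁻¹ *ᵥ b) ⬝ᵥ (A *ᵥ Pi.single w 1) = x := by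
    rw [dotProduct_mulVec, ← mulVec_transpose, hs, h3]; simp [hb]
  have h5 : (A *ᵥ Pi.single w 1) w = 1 := by simp [hw]
  simp only [star_trivial, mulVec_sub, mulVec_smul, h3, sub_dotProduct, dotProduct_sub,
    smul_dotProduct, dotProduct_smul, h4, smul_eq_mul, single_one_dotProduct, h5, hb] at h2
  rw [dotProduct_comm] at h2
  nlinarith

open Matrix in
theorem aux_exist {m : Type*} [Fintype m] [DecidableEq m] (A : Matrix m m ℝ)
    (hA : A.PosDef) (w : m) (x : ℝ) (hw : A w w = 1) (hx : 0 < 1 - x ^ 2) :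
    ∃ M : Matrix (m ⊕ Unit) (m ⊕ Unit) ℝ, M.PosDef ∧ (∀ i j, M (.inl i) (.inl j) = A i j) ∧
      M (.inr ()) (.inr ()) = 1 ∧ M (.inl w) (.inr ()) = x ∧ M.det = A.det * (1 - x ^ 2) := by
  have hs : Aᵀ = A := by simpa using hA.isHermitian.eq
  have hu : IsUnit A.det := (Matrix.isUnit_iff_isUnit_det A).1 hA.isUnit
  have : Invertible A := hA.isUnit.invertible
  set b : m → ℝ := x • (A *ᵥ Pi.single w 1) with hb
  have hbw : b w = x := by simp [hb, hw]
  have h3 : A⁻¹ *ᵥ b = x • Pi.single w 1 := by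
    rw [hb, mulVec_smul, mulVec_mulVec, Matrix.nonsing_inv_mul _ hu, one_mulVec]
  have h1 : (1 - replicateRow Unit b * A⁻¹ * replicateCol Unit b : Matrix Unit Unit ℝ) default default
      = 1 - b ⬝ᵥ (A⁻¹ *ᵥ b) := by
    rw [Matrix.mul_assoc]
    simp [Matrix.mul_apply, dotProduct, mulVec]
  have h4 : b ⬝ᵥ (A⁻¹ *ᵥ b) = x ^ 2 := by
    rw [h3, dotProduct_smul, dotProduct_single_one, hbw, smul_eq_mul, sq]
  have hdet : (Matrix.fromBlocks A (replicateCol Unit b) (replicateRow Unit b) 1).det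
      = A.det * (1 - x ^ 2) := by
    rw [Matrix.det_fromBlocks₁₁, Matrix.det_unique (n := Unit), Matrix.invOf_eq_nonsing_inv, h1, h4]
  have hct : replicateRow Unit b = (replicateCol Unit b)ᴴ := by
    ext; simp
  refine ⟨Matrix.fromBlocks A (replicateCol Unit b) (replicateRow Unit b) 1, ?_, ?_, ?_, ?_, hdet⟩
  · have hps : (Matrix.fromBlocks A (replicateCol Unit b) (replicateRow Unit b) 1).PosSemidef := by
      rw [hct, Matrix.PosDef.fromBlocks₁₁ _ _ hA, ← hct]
      have : (1 - replicateRow Unit b * A⁻¹ * replicateCol Unit b : Matrix Unit Unit ℝ)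
          = diagonal (fun _ => 1 - x ^ 2) := by
        ext i j
        have := h1
        rw [h4] at this
        simpa using this
      rw [this]
      exact PosSemidef.diagonal (fun _ => hx.le)
    refine (hps.posDef_iff_isUnit).2 ?_
    rw [Matrix.isUnit_iff_isUnit_det, hdet]
    exact (mul_pos hA.det_pos hx).ne'.isUnit
  · simp
  · simp
  · simpa using hbw

theorem aux_tree (x : ℝ) (hx : 0 < 1 - x ^ 2) (n : ℕ) : ∀ (V : Type*) [Fintype V] [DecidableEq V]
    (G : SimpleGraph V), G.IsTree → Fintype.card V = n + 1 →
    IsGreatest (Matrix.det '' Psi G x) ((1 - x ^ 2) ^ n) := by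
  induction n with
  | zero =>
    intro V _ _ G hG hc
    obtain ⟨v, hv⟩ := Fintype.card_eq_one_iff.1 hc
    have : Unique V := ⟨⟨v⟩, hv⟩
    constructor
    · refine ⟨1, ⟨Matrix.PosDef.one, by simp, ?_⟩, by simp⟩
      intro i j h
      exact absurd (Subsingleton.elim i j) h.ne
    · rintro _ ⟨M, ⟨_, h, _⟩, rfl⟩
      rw [Matrix.det_unique, h]; simp
  | succ n ih =>
    intro V _ _ G hG hc
    classical
    have : Nontrivial V := Fintype.one_lt_card_iff_nontrivial.1 (by omega)
    obtain ⟨v, hv⟩ := hG.exists_vert_degree_one_of_nontrivial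
    obtain ⟨w, hvw, hw⟩ := G.degree_eq_one_iff_existsUnique_adj.1 hv
    have hT : (G.induce {v}ᶜ).IsTree :=
      ⟨hG.connected.induce_compl_singleton_of_degree_eq_one hv, hG.isAcyclic.induce _⟩
    have hcard : Fintype.card ({v}ᶜ : Set V) = n + 1 := by
      rw [Fintype.card_compl_set]; simp [hc]
    obtain ⟨⟨A, ⟨hA, hA1, hAx⟩, hAd⟩, hmax⟩ := ih _ (G.induce {v}ᶜ) hT hcard
    let w' : ({v}ᶜ : Set V) := ⟨w, hvw.ne'⟩
    let e : ({v}ᶜ : Set V) ⊕ Unit ≃ V := Equiv.ofBijective (Sum.elim Subtype.val (fun _ => v)) (by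
      constructor
      · rintro (⟨a, ha⟩ | a) (⟨b, hb⟩ | b) h
        · simpa using h
        · exact absurd h ha
        · exact absurd h.symm hb
        · rfl
      · intro a
        by_cases h : a = v
        · exact ⟨.inr (), h.symm⟩
        · exact ⟨.inl ⟨a, h⟩, rfl⟩)
    have el : ∀ i, e (.inl i) = i := fun _ => rfl
    have er : ∀ i, e (.inr i) = v := fun _ => rfl
    constructor
    · obtain ⟨M, hM, hMA, hM1, hMx, hMd⟩ := aux_exist A hA w' x (hA1 _) hx
      refine ⟨M.submatrix e.symm e.symm, ⟨hM.submatrix e.symm.injective, ?_, ?_⟩, ?_⟩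
      · intro i
        obtain ⟨i, rfl⟩ := e.surjective i
        rcases i with i | i
        · simp [hMA, hA1]
        · simpa using hM1
      · intro i j
        obtain ⟨i, rfl⟩ := e.surjective i
        obtain ⟨j, rfl⟩ := e.surjective j
        have hMx' : M (.inr ()) (.inl w') = x := by
          rw [← hM.isHermitian.apply]; simpa using hMx
        rcases i with i | i <;> rcases j with j | j <;> intro h <;>
          simp only [Matrix.submatrix_apply, Equiv.symm_apply_apply]
        · rw [hMA]; exact hAx _ _ h
        · have : i = w' := Subtype.ext (hw _ h.symm)
          rw [this]; exact hMx
        · have : j = w' := Subtype.ext (hw _ h)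
          rw [this]; exact hMx'
        · exact absurd rfl h.ne
      · rw [Matrix.det_submatrix_equiv_self, hMd, hAd, pow_succ _ n]
    · rintro _ ⟨M, ⟨hM, h1, hMx⟩, rfl⟩
      have hB : (M.submatrix Subtype.val Subtype.val : Matrix ({v}ᶜ : Set V) ({v}ᶜ : Set V) ℝ).PosDef :=
        hM.submatrix Subtype.val_injective
      have hle := hmax ⟨_, ⟨hB, fun i => h1 _, fun i j h => hMx _ _ h⟩, rfl⟩
      have := aux_upper (M.submatrix Subtype.val Subtype.val)
        (fun i : ({v}ᶜ : Set V) => M i v) hB w' x (h1 _) (hMx _ _ hvw.symm)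
      rw [← Matrix.det_submatrix_equiv_self e M]
      have heq : M.submatrix e e = Matrix.fromBlocks (M.submatrix Subtype.val Subtype.val)
          (Matrix.replicateCol Unit (fun i : ({v}ᶜ : Set V) => M i v))
          (Matrix.replicateRow Unit (fun i : ({v}ᶜ : Set V) => M i v)) 1 := by
        ext i j
        rcases i with i | i <;> rcases j with j | j <;> simp [el, er, h1]
        simpa using (hM.isHermitian.apply v j).symm
      rw [heq, pow_succ _ n]
      exact this.trans (mul_le_mul_of_nonneg_right hle hx.le)

/-- If `G` is a tree then `τ(G,x) = (1-x²)^{|E(G)|}`: this value is the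
attained maximum of the determinant over `Ψ(G,x)`. -/
theorem tau_tree {V : Type*} [Fintype V] [DecidableEq V] (G : SimpleGraph V)
    [DecidableRel G.Adj] (hG : G.IsTree) (x : ℝ) (hx : x ∈ Set.Ioo (-1 : ℝ) 1) :
    IsGreatest (Matrix.det '' Psi G x) ((1 - x ^ 2) ^ G.edgeFinset.card) := by
  refine aux_tree x (by nlinarith [hx.1, hx.2]) _ V G hG ?_
  exact hG.card_edgeFinset.symm
end

section
/- The Euclidean volume of the set 𝓜_k of positive semidefinite real symmetric k×k matrices with all diagonal entries equal to 1 (as a subset of the k(k-1)/2-dimensional space of off-diagonal entries) equals Γ((k+1)/2)^{-k} · Γ_k((k+1)/2), where Γ_k is the multivariate gamma function. -/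
open MeasureTheory

noncomputable def multivariateGamma (k : ℕ) (a : ℝ) : ℝ :=
  Real.pi ^ ((k * (k - 1) : ℝ) / 4) *
    ∏ j ∈ Finset.range k, Real.Gamma (a + (1 - ((j : ℝ) + 1)) / 2)

/-- The symmetric matrix with unit diagonal determined by its strictly
upper-triangular entries. -/
def toSymMat (k : ℕ) (y : {p : Fin k × Fin k // p.1 < p.2} → ℝ) :
    Matrix (Fin k) (Fin k) ℝ :=
  Matrix.of fun i j =>
    if h : i < j then y ⟨(i, j), h⟩
    else if h' : j < i then y ⟨(j, i), h'⟩
    else 1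


noncomputable def gfun (s t : ℝ) : ℝ := if 0 < t then t ^ s else 0

lemma gfun_nonneg (s t : ℝ) : 0 ≤ gfun s t := by
  unfold gfun; split_ifs with h
  · positivity
  · exact le_rfl

lemma measurable_gfun (s : ℝ) : Measurable (gfun s) :=
  Measurable.ite measurableSet_Ioi (by fun_prop) (by fun_prop)

lemma integral_betaPDFReal {a b : ℝ} (ha : 0 < a) (hb : 0 < b) :
    ∫ x in Set.Ioi (0:ℝ), ProbabilityTheory.betaPDFReal a b x = 1 := by
  rw [setIntegral_eq_integral_of_forall_compl_eq_zero]
  · rw [integral_eq_lintegral_of_nonneg_ae]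
    · have := ProbabilityTheory.lintegral_betaPDF_eq_one ha hb
      simp only [ProbabilityTheory.betaPDF] at this
      simp [this]
    · filter_upwards with x
      by_cases h : 0 < x ∧ x < 1
      · exact (ProbabilityTheory.betaPDFReal_pos h.1 h.2 ha hb).le
      · simp [ProbabilityTheory.betaPDFReal, h]
    · exact (ProbabilityTheory.measurable_betaPDFReal a b).aestronglyMeasurable
  · intro x hx
    have : ¬ 0 < x := hx
    simp [ProbabilityTheory.betaPDFReal, this]

lemma radial (n : ℕ) (hn : 1 ≤ n) (s : ℝ) (hs : 0 ≤ s) :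
    ∫ y in Set.Ioi (0:ℝ), y ^ (n - 1) • gfun s (1 - y ^ 2) =
      ProbabilityTheory.beta (n / 2) (s + 1) / 2 := by
  have hn' : (0:ℝ) < n / 2 := by positivity
  have hb := ProbabilityTheory.beta_pos hn' (by positivity : 0 < s + 1)
  have h1 := integral_comp_rpow_Ioi_of_pos
    (g := fun t => ProbabilityTheory.betaPDFReal (n / 2) (s + 1) t) (p := 2) (by norm_num)
  rw [integral_betaPDFReal hn' (by positivity)] at h1
  trans ProbabilityTheory.beta (n / 2) (s + 1) / 2 * ∫ x in Set.Ioi (0:ℝ), (2 * x ^ ((2:ℝ) - 1)) •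
      ProbabilityTheory.betaPDFReal (n / 2) (s + 1) (x ^ (2:ℝ))
  swap
  · rw [h1, mul_one]
  rw [← integral_const_mul]
  refine setIntegral_congr_fun measurableSet_Ioi fun x hx => ?_
  have hx : 0 < x := hx
  simp only [smul_eq_mul, ProbabilityTheory.betaPDFReal, gfun]
  have e2 : x ^ (2:ℝ) = x ^ 2 := by norm_cast
  rw [e2]
  by_cases h : x ^ 2 < 1
  · have : 0 < 1 - x ^ 2 := by linarith
    rw [if_pos this, if_pos ⟨by positivity, h⟩]
    have e3 : x ^ (n - 1) = x ^ ((2:ℝ) - 1) * (x ^ 2) ^ ((n:ℝ) / 2 - 1) := by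
      rw [← e2, ← Real.rpow_mul hx.le, ← Real.rpow_add hx, ← Real.rpow_natCast]
      congr 1
      push_cast [hn]; ring
    rw [e3, add_sub_cancel_right]
    field_simp
  · have : ¬ 0 < 1 - x ^ 2 := by linarith
    rw [if_neg this, if_neg (by tauto)]
    simp

noncomputable def cst (n : ℕ) (s : ℝ) : ℝ :=
  Real.pi ^ ((n:ℝ) / 2) * Real.Gamma (s + 1) / Real.Gamma (s + 1 + n / 2)

lemma cst_pos (n : ℕ) (s : ℝ) (hs : 0 ≤ s) : 0 < cst n s := by
  unfold cst
  have := Real.Gamma_pos_of_pos (by positivity : 0 < s + 1)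
  have := Real.Gamma_pos_of_pos (by positivity : 0 < s + 1 + n / 2)
  positivity

lemma ball_integral (n : ℕ) (hn : 1 ≤ n) (s : ℝ) (hs : 0 ≤ s) :
    ∫⁻ u : Fin n → ℝ, ENNReal.ofReal (gfun s (1 - u ⬝ᵥ u)) = ENNReal.ofReal (cst n s) := by
  have : Nonempty (Fin n) := ⟨⟨0, hn⟩⟩
  have : Nontrivial (EuclideanSpace ℝ (Fin n)) := by
    have : NeZero n := ⟨by omega⟩
    infer_instance
  have h0 : ∫⁻ u : Fin n → ℝ, ENNReal.ofReal (gfun s (1 - u ⬝ᵥ u)) =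
      ∫⁻ x : EuclideanSpace ℝ (Fin n), ENNReal.ofReal (gfun s (1 - ‖x‖ ^ 2)) := by
    rw [← (PiLp.volume_preserving_ofLp (Fin n)).lintegral_comp_emb
      (MeasurableEquiv.toLp 2 (Fin n → ℝ)).symm.measurableEmbedding]
    refine lintegral_congr fun x => ?_
    rw [EuclideanSpace.norm_sq_eq]
    simp [dotProduct, sq]
  have h1 : ∫ x : EuclideanSpace ℝ (Fin n), gfun s (1 - ‖x‖ ^ 2) = cst n s := by
    rw [integral_fun_norm_addHaar volume (fun r => gfun s (1 - r ^ 2))]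
    simp only [finrank_euclideanSpace_fin]
    rw [radial n hn s hs, Measure.real, EuclideanSpace.volume_ball]
    have hpos : 0 < Real.Gamma ((n:ℝ) / 2 + 1) := Real.Gamma_pos_of_pos (by positivity)
    rw [ENNReal.ofReal_one, one_pow, one_mul, Fintype.card_fin,
      ENNReal.toReal_ofReal (by positivity)]
    have hn' : (0:ℝ) < n / 2 := by positivity
    rw [ProbabilityTheory.beta, Real.Gamma_add_one hn'.ne', cst]
    have e : √Real.pi ^ n = Real.pi ^ ((n:ℝ) / 2) := by
      rw [Real.sqrt_eq_rpow, ← Real.rpow_natCast, ← Real.rpow_mul Real.pi_pos.le]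
      congr 1; ring
    rw [e]
    have := Real.Gamma_pos_of_pos hn'
    have h5 : (n:ℝ) / 2 + (s + 1) = s + 1 + n / 2 := by ring
    have := Real.Gamma_pos_of_pos (by positivity : 0 < s + 1 + (n:ℝ) / 2)
    rw [h5]
    simp only [nsmul_eq_mul, smul_eq_mul]
    have : (n:ℝ) ≠ 0 := by positivity
    field_simp
  have h2 : Integrable fun x : EuclideanSpace ℝ (Fin n) => gfun s (1 - ‖x‖ ^ 2) := by
    by_contra h
    have := cst_pos n s hs
    rw [integral_undef h] at h1
    linarith
  rw [h0, ← ofReal_integral_eq_lintegral_ofReal h2 (.of_forall fun x => gfun_nonneg _ _), h1]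

open scoped MatrixOrder in
lemma exists_factor {n : ℕ} {A : Matrix (Fin n) (Fin n) ℝ} (hA : A.PosDef) :
    ∃ M : Matrix (Fin n) (Fin n) ℝ, A = M * M.transpose := by
  obtain ⟨y, hy⟩ := CStarAlgebra.nonneg_iff_eq_star_mul_self.mp hA.posSemidef.nonneg
  refine ⟨y.transpose, ?_⟩
  rw [hy, Matrix.transpose_transpose]
  rfl

lemma inner_integral (n : ℕ) (hn : 1 ≤ n) (s : ℝ) (hs : 0 ≤ s)
    {A : Matrix (Fin n) (Fin n) ℝ} (hA : A.PosDef) :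
    ∫⁻ b : Fin n → ℝ, ENNReal.ofReal (gfun s (1 - b ⬝ᵥ (A⁻¹.mulVec b))) =
      ENNReal.ofReal (A.det ^ (1 / 2 : ℝ)) * ENNReal.ofReal (cst n s) := by
  obtain ⟨M, hM⟩ := exists_factor hA
  have hdet : A.det = M.det ^ 2 := by rw [hM, Matrix.det_mul, Matrix.det_transpose, sq]
  have hpos := hA.det_pos
  have hne : M.det ≠ 0 := by
    intro h; rw [h] at hdet; simp at hdet; linarith
  have hmap := Real.map_matrix_volume_pi_eq_smul_volume_pi hne
  have hmeas : Measurable fun b : Fin n → ℝ =>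
      ENNReal.ofReal (gfun s (1 - b ⬝ᵥ (A⁻¹.mulVec b))) := by
    refine ENNReal.measurable_ofReal.comp ((measurable_gfun s).comp ?_)
    apply Continuous.measurable
    fun_prop
  have h1 := congrArg (fun μ => ∫⁻ b, ENNReal.ofReal (gfun s (1 - b ⬝ᵥ (A⁻¹.mulVec b))) ∂μ) hmap
  rw [lintegral_map hmeas (by
      apply Continuous.measurable
      exact (Matrix.toLin' M).continuous_of_finiteDimensional), lintegral_smul_measure] at h1
  have h2 : ∀ u : Fin n → ℝ, (Matrix.toLin' M u) ⬝ᵥ (A⁻¹.mulVec (Matrix.toLin' M u)) = u ⬝ᵥ u := by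
    intro u
    have hu : IsUnit M.det := hne.isUnit
    have hu' : IsUnit M.transpose.det := by rwa [Matrix.det_transpose]
    rw [Matrix.toLin'_apply, hM, Matrix.mul_inv_rev, Matrix.mulVec_mulVec, Matrix.mul_assoc,
      Matrix.nonsing_inv_mul _ hu, Matrix.mul_one, Matrix.dotProduct_mulVec, 
      ← Matrix.mulVec_transpose, Matrix.mulVec_mulVec, Matrix.transpose_nonsing_inv,
      Matrix.transpose_transpose, Matrix.nonsing_inv_mul _ hu, Matrix.one_mulVec]
  simp_rw [h2] at h1
  rw [ball_integral n hn s hs] at h1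
  have h3 : A.det ^ (1 / 2 : ℝ) = |M.det| := by
    rw [← Real.sqrt_eq_rpow, hdet, Real.sqrt_sq_eq_abs]
  rw [h1, h3, smul_eq_mul, ← mul_assoc, ← ENNReal.ofReal_mul (by positivity), abs_inv,
    mul_inv_cancel₀ (by positivity), ENNReal.ofReal_one, one_mul]

/-- index set -/
abbrev Idx (k : ℕ) := {p : Fin k × Fin k // p.1 < p.2}

def sigFun (k : ℕ) : Idx k ⊕ Fin k → Idx (k + 1) :=
  Sum.elim (fun p => ⟨(p.1.1.castSucc, p.1.2.castSucc), by simpa using p.2⟩)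
    (fun i => ⟨(i.castSucc, Fin.last k), Fin.castSucc_lt_last i⟩)

lemma sigFun_bij (k : ℕ) : Function.Bijective (sigFun k) := by
  constructor
  · rintro (⟨⟨a, b⟩, h⟩ | i) (⟨⟨c, d⟩, h'⟩ | j) hh
    · simpa [sigFun] using hh
    · simp [sigFun] at hh
    · simp [sigFun] at hh
      exact absurd hh.2.symm (Fin.castSucc_lt_last _).ne
    · simpa [sigFun] using hh
  · rintro ⟨⟨a, b⟩, h⟩
    induction a using Fin.lastCases with
    | last => exact absurd h (by simpa using Fin.le_last _)
    | cast a =>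
      induction b using Fin.lastCases with
      | last => exact ⟨Sum.inr a, rfl⟩
      | cast b => exact ⟨Sum.inl ⟨(a, b), by simpa using h⟩, rfl⟩

noncomputable def sig (k : ℕ) : Idx k ⊕ Fin k ≃ Idx (k + 1) := Equiv.ofBijective _ (sigFun_bij k)

noncomputable def glue (k : ℕ) : ((Idx k → ℝ) × (Fin k → ℝ)) ≃ᵐ (Idx (k + 1) → ℝ) :=
  (MeasurableEquiv.sumPiEquivProdPi (fun _ : Idx k ⊕ Fin k => ℝ)).symm.trans
    (MeasurableEquiv.piCongrLeft (fun _ => ℝ) (sig k))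

lemma glue_mp (k : ℕ) : MeasurePreserving (glue k) volume volume :=
  (volume_measurePreserving_piCongrLeft (fun _ => ℝ) (sig k)).comp
    (volume_measurePreserving_sumPiEquivProdPi_symm (fun _ : Idx k ⊕ Fin k => ℝ))

lemma glue_apply (k : ℕ) (z : (Idx k → ℝ) × (Fin k → ℝ)) (q : Idx k ⊕ Fin k) :
    glue k z (sigFun k q) = Sum.elim z.1 z.2 q := by
  have : sigFun k q = sig k q := rfl
  rw [this]
  simp only [glue, MeasurableEquiv.trans_apply, MeasurableEquiv.coe_piCongrLeft]
  rw [Equiv.piCongrLeft_apply_apply]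
  cases q <;> rfl

lemma glue_inl (k : ℕ) (y : Idx k → ℝ) (b : Fin k → ℝ) (i j : Fin k)
    (h : i.castSucc < j.castSucc) :
    glue k (y, b) ⟨(i.castSucc, j.castSucc), h⟩ = y ⟨(i, j), by simpa using h⟩ :=
  glue_apply k (y, b) (Sum.inl ⟨(i, j), by simpa using h⟩)

lemma glue_inr (k : ℕ) (y : Idx k → ℝ) (b : Fin k → ℝ) (i : Fin k)
    (h : i.castSucc < Fin.last k) :
    glue k (y, b) ⟨(i.castSucc, Fin.last k), h⟩ = b i :=
  glue_apply k (y, b) (Sum.inr i)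

lemma toSymMat_glue (k : ℕ) (y : Idx k → ℝ) (b : Fin k → ℝ) :
    (toSymMat (k + 1) (glue k (y, b))).submatrix finSumFinEquiv finSumFinEquiv =
      Matrix.fromBlocks (toSymMat k y) (Matrix.replicateCol (Fin 1) b)
        (Matrix.replicateCol (Fin 1) b).conjTranspose 1 := by
  ext i j
  rcases i with i | i <;> rcases j with j | j
  · simp only [Matrix.submatrix_apply, finSumFinEquiv_apply_left, Matrix.fromBlocks_apply₁₁,
      toSymMat, Matrix.of_apply]
    have e : ∀ i : Fin k, Fin.castAdd 1 i = i.castSucc := fun _ => rfl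
    simp only [e, glue_inl, Fin.castSucc_lt_castSucc_iff]
  · obtain rfl : j = 0 := Subsingleton.elim _ _
    have e : ∀ i : Fin k, Fin.castAdd 1 i = i.castSucc := fun _ => rfl
    have e' : Fin.natAdd k (0 : Fin 1) = Fin.last k := rfl
    simp only [Matrix.submatrix_apply, finSumFinEquiv_apply_left, finSumFinEquiv_apply_right,
      Matrix.fromBlocks_apply₁₂, toSymMat, Matrix.of_apply, e, e', Fin.castSucc_lt_last,
      dite_true, glue_inr, Matrix.replicateCol_apply]
  · obtain rfl : i = 0 := Subsingleton.elim _ _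
    have e : ∀ i : Fin k, Fin.castAdd 1 i = i.castSucc := fun _ => rfl
    have e' : Fin.natAdd k (0 : Fin 1) = Fin.last k := rfl
    have e3 : ¬ Fin.last k < j.castSucc := not_lt.2 (Fin.le_last _)
    simp only [Matrix.submatrix_apply, finSumFinEquiv_apply_left, finSumFinEquiv_apply_right,
      Matrix.fromBlocks_apply₂₁, toSymMat, Matrix.of_apply, e, e', e3, Fin.castSucc_lt_last,
      dite_true, dite_false, glue_inr, Matrix.conjTranspose_apply, Matrix.replicateCol_apply,
      star_trivial]
  · obtain rfl : i = 0 := Subsingleton.elim _ _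
    obtain rfl : j = 0 := Subsingleton.elim _ _
    simp [toSymMat]

lemma schur_entry {k : ℕ} (A : Matrix (Fin k) (Fin k) ℝ) (b : Fin k → ℝ) :
    (1 - (Matrix.replicateCol (Fin 1) b).conjTranspose * A⁻¹ * Matrix.replicateCol (Fin 1) b) =
      Matrix.diagonal (fun _ : Fin 1 => 1 - b ⬝ᵥ (A⁻¹.mulVec b)) := by
  ext i j
  obtain rfl : i = 0 := Subsingleton.elim _ _
  obtain rfl : j = 0 := Subsingleton.elim _ _
  rw [Matrix.mul_assoc]
  simp [Matrix.mul_apply, dotProduct, Matrix.mulVec]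

lemma det_glue (k : ℕ) (y : Idx k → ℝ) (b : Fin k → ℝ) (hA : (toSymMat k y).PosDef) :
    (toSymMat (k + 1) (glue k (y, b))).det =
      (toSymMat k y).det * (1 - b ⬝ᵥ ((toSymMat k y)⁻¹.mulVec b)) := by
  rw [← Matrix.det_submatrix_equiv_self finSumFinEquiv, toSymMat_glue]
  let := hA.isUnit.invertible
  rw [Matrix.det_fromBlocks₁₁, Matrix.invOf_eq_nonsing_inv, schur_entry]
  simp

lemma posDef_glue (k : ℕ) (y : Idx k → ℝ) (b : Fin k → ℝ) :
    (toSymMat (k + 1) (glue k (y, b))).PosDef ↔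
      (toSymMat k y).PosDef ∧ 0 < 1 - b ⬝ᵥ ((toSymMat k y)⁻¹.mulVec b) := by
  have hps : (toSymMat k y).PosDef → ((toSymMat (k + 1) (glue k (y, b))).PosSemidef ↔
      0 ≤ 1 - b ⬝ᵥ ((toSymMat k y)⁻¹.mulVec b)) := by
    intro hA
    let := hA.isUnit.invertible
    rw [← Matrix.posSemidef_submatrix_equiv finSumFinEquiv, toSymMat_glue,
      Matrix.PosDef.fromBlocks₁₁ _ _ hA, schur_entry]
    simp
  constructor
  · intro h
    have hA : (toSymMat k y).PosDef := by
      have h1 := h.submatrix (e := fun i : Fin k => finSumFinEquiv (Sum.inl i : Fin k ⊕ Fin 1))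
        (finSumFinEquiv.injective.comp Sum.inl_injective)
      have h2 := congrArg Matrix.toBlocks₁₁ (toSymMat_glue k y b)
      rw [Matrix.toBlocks_fromBlocks₁₁] at h2
      rw [← h2]
      exact h1
    refine ⟨hA, ?_⟩
    have h3 := h.det_pos
    rw [det_glue k y b hA] at h3
    exact pos_of_mul_pos_right h3 hA.det_pos.le
  · rintro ⟨hA, hb⟩
    rw [((hps hA).2 hb.le).posDef_iff_det_ne_zero, det_glue k y b hA]
    have := hA.det_pos
    positivity

open Classical in
noncomputable def dens (k : ℕ) (s : ℝ) (y : Idx k → ℝ) : ENNReal :=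
  if (toSymMat k y).PosDef then ENNReal.ofReal ((toSymMat k y).det ^ s) else 0

lemma continuous_toSymMat (k : ℕ) : Continuous (toSymMat k) := by
  refine continuous_matrix fun i j => ?_
  simp only [toSymMat, Matrix.of_apply]
  split_ifs <;> fun_prop

lemma toSymMat_isHermitian (k : ℕ) (y : Idx k → ℝ) : (toSymMat k y).IsHermitian := by
  ext i j
  simp only [Matrix.conjTranspose_apply, toSymMat, Matrix.of_apply, star_trivial]
  rcases lt_trichotomy i j with h | h | h
  · simp [h, h.not_gt]
  · simp [h]
  · simp [h, h.not_gt]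

lemma isClosed_psd (k : ℕ) : IsClosed {y : Idx k → ℝ | (toSymMat k y).PosSemidef} := by
  simp only [Matrix.posSemidef_iff_dotProduct_mulVec, toSymMat_isHermitian, true_and,
    Set.ofPred_forall]
  refine isClosed_iInter fun x => ?_
  have := continuous_toSymMat k
  exact isClosed_le continuous_const (by fun_prop)

lemma measurableSet_pd (k : ℕ) : MeasurableSet {y : Idx k → ℝ | (toSymMat k y).PosDef} := by
  have : {y : Idx k → ℝ | (toSymMat k y).PosDef} =
      {y : Idx k → ℝ | (toSymMat k y).PosSemidef} ∩ {y | (toSymMat k y).det = 0}ᶜ := by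
    ext y
    constructor
    · intro h
      exact ⟨h.posSemidef, h.det_pos.ne'⟩
    · rintro ⟨h1, h2⟩
      exact h1.posDef_iff_det_ne_zero.2 h2
  rw [this]
  have := continuous_toSymMat k
  exact (isClosed_psd k).measurableSet.inter
    (isClosed_eq (by fun_prop) continuous_const).measurableSet.compl

lemma measurable_dens (k : ℕ) (s : ℝ) : Measurable (dens k s) := by
  refine Measurable.ite (measurableSet_pd k) ?_ measurable_const
  have : Measurable fun y => (toSymMat k y).det :=
    Continuous.measurable (by have := continuous_toSymMat k; fun_prop)
  fun_prop

lemma dens_glue (k : ℕ) (s : ℝ) (y : Idx k → ℝ) (b : Fin k → ℝ) :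
    dens (k + 1) s (glue k (y, b)) =
      dens k s y * ENNReal.ofReal (gfun s (1 - b ⬝ᵥ ((toSymMat k y)⁻¹.mulVec b))) := by
  unfold dens gfun
  rw [posDef_glue]
  by_cases hA : (toSymMat k y).PosDef
  · by_cases hb : 0 < 1 - b ⬝ᵥ ((toSymMat k y)⁻¹.mulVec b)
    · have := hA.det_pos
      simp only [hA, hb, and_self, if_true]
      rw [det_glue k y b hA, Real.mul_rpow (by positivity) hb.le,
        ENNReal.ofReal_mul (by positivity)]
    · simp only [hA, hb, and_false, if_false, ENNReal.ofReal_zero, mul_zero]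
  · simp [hA]

lemma lintegral_dens_succ (k : ℕ) (hk : 1 ≤ k) (s : ℝ) (hs : 0 ≤ s) :
    ∫⁻ y, dens (k + 1) s y = (∫⁻ y, dens k (s + 1 / 2) y) * ENNReal.ofReal (cst k s) := by
  rw [← (glue_mp k).lintegral_comp_emb (glue k).measurableEmbedding, Measure.volume_eq_prod,
    lintegral_prod (fun z => dens (k + 1) s (glue k z))
      (((measurable_dens (k+1) s).comp (glue k).measurable).aemeasurable),
    ← lintegral_mul_const _ (measurable_dens _ _)]
  refine lintegral_congr fun y => ?_
  simp_rw [dens_glue]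
  have hfin : dens k s y ≠ ⊤ := by unfold dens; split_ifs <;> simp
  rw [lintegral_const_mul' _ _ hfin]
  by_cases hA : (toSymMat k y).PosDef
  · rw [inner_integral k hk s hs hA, ← mul_assoc]
    have := hA.det_pos
    simp only [dens, hA, if_true]
    rw [← ENNReal.ofReal_mul (by positivity), ← Real.rpow_add this]
  · simp [dens, hA]

lemma lintegral_dens (k : ℕ) : ∀ (s : ℝ), 0 ≤ s →
    ∫⁻ y, dens (k + 1) s y = ENNReal.ofReal (∏ j ∈ Finset.range k,
      cst (j + 1) (s + ((k:ℝ) - 1 - j) / 2)) := by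
  induction k with
  | zero =>
    intro s hs
    have hsub : Subsingleton (Fin (0 + 1)) := inferInstanceAs (Subsingleton (Fin 1))
    have : IsEmpty (Idx (0 + 1)) := ⟨fun p => by
      obtain ⟨⟨a, b⟩, h⟩ := p
      have := Subsingleton.elim a b
      simp [this] at h⟩
    have hd : ∀ y, dens (0 + 1) s y = 1 := by
      intro y
      have : toSymMat (0 + 1) y = 1 := by
        ext i j
        have := Subsingleton.elim i j
        subst this
        simp [toSymMat]
      unfold dens
      rw [this]
      simp [Matrix.PosDef.one]
    simp [hd, volume_pi]
  | succ k ih =>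
    intro s hs
    rw [lintegral_dens_succ (k + 1) (by omega) s hs, ih _ (by positivity),
      Finset.prod_range_succ, ENNReal.ofReal_mul]
    · congr 2
      · refine Finset.prod_congr rfl fun j _ => ?_
        congr 1; push_cast; ring
      · congr 1; push_cast; ring
    · refine Finset.prod_nonneg fun j hj => (cst_pos _ _ ?_).le
      have : j + 1 ≤ k := Finset.mem_range.1 hj
      have : (j:ℝ) + 1 ≤ k := by exact_mod_cast this
      push_cast
      have : 0 ≤ ((k:ℝ) + 1 - 1 - j) := by linarith
      positivity

lemma volume_pd (k : ℕ) : volume {y : Idx k → ℝ | (toSymMat k y).PosDef} =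
    ∫⁻ y, dens k 0 y := by
  rw [← lintegral_indicator_one (measurableSet_pd k)]
  refine lintegral_congr fun y => ?_
  by_cases hA : (toSymMat k y).PosDef <;> simp [dens, Set.indicator, hA]

lemma toSymMat_smul (k : ℕ) (r : ℝ) (y : Idx k → ℝ) :
    toSymMat k (r • y) = r • toSymMat k y + (1 - r) • (1 : Matrix (Fin k) (Fin k) ℝ) := by
  ext i j
  simp only [toSymMat, Matrix.of_apply, Matrix.add_apply, Matrix.smul_apply, Pi.smul_apply,
    smul_eq_mul, Matrix.one_apply]
  rcases lt_trichotomy i j with h | h | h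
  · simp [h, h.ne]
  · simp [h]
  · simp [h, h.not_gt, h.ne']

open scoped Pointwise in
lemma volume_psd (k : ℕ) : volume {y : Idx k → ℝ | (toSymMat k y).PosSemidef} =
    volume {y : Idx k → ℝ | (toSymMat k y).PosDef} := by
  refine le_antisymm ?_ (measure_mono fun y hy => Matrix.PosDef.posSemidef hy)
  set S := {y : Idx k → ℝ | (toSymMat k y).PosSemidef}
  set T := {y : Idx k → ℝ | (toSymMat k y).PosDef}
  have key : ∀ r ∈ Set.Ioo (0:ℝ) 1,
      ENNReal.ofReal (r ^ (Module.finrank ℝ (Idx k → ℝ))) * volume S ≤ volume T := by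
    intro r hr
    have hsub : r • S ⊆ T := by
      rintro _ ⟨y, hy, rfl⟩
      change (toSymMat k (r • y)).PosDef
      rw [toSymMat_smul]
      have hy : (toSymMat k y).PosSemidef := hy
      exact Matrix.PosDef.posSemidef_add (hy.smul hr.1.le)
        (Matrix.PosDef.one.smul (sub_pos.2 hr.2))
    have := measure_mono (μ := volume) hsub
    rwa [Measure.addHaar_smul, abs_of_nonneg (pow_nonneg hr.1.le _)] at this
  have hlim : Filter.Tendsto
      (fun r : ℝ => ENNReal.ofReal (r ^ (Module.finrank ℝ (Idx k → ℝ))) * volume S)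
      (nhdsWithin 1 (Set.Iio 1)) (nhds (1 * volume S)) := by
    refine ENNReal.Tendsto.mul_const ?_ (Or.inl one_ne_zero)
    have : Continuous fun r : ℝ => ENNReal.ofReal (r ^ (Module.finrank ℝ (Idx k → ℝ))) :=
      ENNReal.continuous_ofReal.comp (continuous_pow _)
    have h := this.tendsto 1
    simp only [one_pow, ENNReal.ofReal_one] at h
    exact h.mono_left nhdsWithin_le_nhds
  rw [one_mul] at hlim
  refine le_of_tendsto hlim ?_
  filter_upwards [Ioo_mem_nhdsLT (zero_lt_one (α := ℝ))] with r hr using key r hr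

theorem volume_elliptope (k : ℕ) (hk : 2 ≤ k) :
    volume {y : {p : Fin k × Fin k // p.1 < p.2} → ℝ | (toSymMat k y).PosSemidef} =
      ENNReal.ofReal
        (multivariateGamma k (((k : ℝ) + 1) / 2) /
          Real.Gamma (((k : ℝ) + 1) / 2) ^ k) := by
  obtain ⟨n, rfl⟩ : ∃ n, k = n + 1 := ⟨k - 1, by omega⟩
  refine (volume_psd (n + 1)).trans ?_
  rw [volume_pd, lintegral_dens n 0 le_rfl]
  congr 1
  have hG : 0 < Real.Gamma ((((n + 1 : ℕ) : ℝ) + 1) / 2) := Real.Gamma_pos_of_pos (by positivity)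
  unfold multivariateGamma cst
  rw [Finset.prod_range_succ']
  have e0 : (((n + 1 : ℕ) : ℝ) + 1) / 2 + (1 - (((0 : ℕ) : ℝ) + 1)) / 2 =
    (((n + 1 : ℕ) : ℝ) + 1) / 2 := by push_cast; ring
  rw [e0]
  have e1 : ∀ j ∈ Finset.range n, Real.pi ^ (((j + 1 : ℕ) : ℝ) / 2) *
      Real.Gamma (0 + ((n:ℝ) - 1 - j) / 2 + 1) /
      Real.Gamma (0 + ((n:ℝ) - 1 - j) / 2 + 1 + ((j + 1 : ℕ) : ℝ) / 2) =
      Real.pi ^ (((j + 1 : ℕ) : ℝ) / 2) *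
      Real.Gamma ((((n + 1 : ℕ) : ℝ) + 1) / 2 + (1 - (((j + 1 : ℕ) : ℝ) + 1)) / 2) /
      Real.Gamma ((((n + 1 : ℕ) : ℝ) + 1) / 2) := by
    intro j _
    congr 3 <;> (push_cast; ring)
  rw [Finset.prod_congr rfl e1, Finset.prod_div_distrib, Finset.prod_mul_distrib,
    Finset.prod_const, Finset.card_range, pow_succ]
  have e2 : ∏ j ∈ Finset.range n, Real.pi ^ (((j + 1 : ℕ) : ℝ) / 2) =
      Real.pi ^ ((((n + 1 : ℕ) : ℝ) * (((n + 1 : ℕ) : ℝ) - 1)) / 4) := by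
    rw [← Real.rpow_sum_of_pos Real.pi_pos]
    congr 1
    clear e1 e0 hG hk
    induction n with
    | zero => simp
    | succ n ih => rw [Finset.sum_range_succ, ih]; push_cast; ring
  rw [e2]
  field_simp
end

section
/- Let G be a bipartite graph with color classes V₁, V₂, a = |V₁|, b = |V₂|, and degrees d₁,…,d_b of the vertices in V₂. Then for every x ∈ (-1,1), τ(G,x) ≥ (1-x²)^{a+b-1} · (1+(a-1)x²) · ∏_{i=1}^{b} (1+(d_i-1)x²)^{-1}, where τ(G,x) is the maximum determinant over Ψ(G,x). -/
open Matrix in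
lemma aux_detA {α : Type*} [Fintype α] [DecidableEq α] (x : ℝ) (h1 : x ^ 2 < 1) :
    ((1 - x ^ 2) • (1 : Matrix α α ℝ) + (x ^ 2) • vecMulVec 1 (star 1)).PosDef ∧
    (1 - x ^ 2) ^ (Fintype.card α - 1) * (1 + ((Fintype.card α : ℝ) - 1) * x ^ 2) ≤
    ((1 - x ^ 2) • (1 : Matrix α α ℝ) + (x ^ 2) • vecMulVec 1 (star 1)).det := by
  have hp : 0 < 1 - x ^ 2 := by linarith
  refine ⟨?_, ?_⟩
  · exact (PosDef.one.smul hp).add_posSemidef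
      ((posSemidef_vecMulVec_self_star _).smul (sq_nonneg x))
  · have e : ((1 - x ^ 2) • (1 : Matrix α α ℝ) + (x ^ 2) • vecMulVec 1 (star 1)) =
        (1 - x ^ 2) • (1 + replicateCol Unit (fun _ : α => x ^ 2 / (1 - x ^ 2)) *
          replicateRow Unit (fun _ : α => (1 : ℝ))) := by
      ext i j
      simp [Matrix.mul_apply, vecMulVec_apply]
      field_simp
    rw [e, det_smul, det_one_add_replicateCol_mul_replicateRow]
    simp only [dotProduct, Finset.sum_const, one_mul, Finset.card_univ, nsmul_eq_mul]
    rcases Nat.eq_zero_or_pos (Fintype.card α) with h | h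
    · rw [h]; simp; nlinarith [sq_nonneg x]
    · obtain ⟨k, hk⟩ := Nat.exists_eq_succ_of_ne_zero h.ne'
      rw [hk]
      apply le_of_eq
      simp only [Nat.succ_eq_add_one, Nat.add_sub_cancel, pow_succ]
      push_cast
      field_simp
      ring

open Matrix in
lemma aux_block {α β : Type*} [Fintype α] [DecidableEq α] [Fintype β] [DecidableEq β]
    (R : α → β → Prop) [∀ u v, Decidable (R u v)] (d : β → ℝ)
    (hd : ∀ v, d v = ∑ u, if R u v then (1 : ℝ) else 0)
    (x : ℝ) (h1 : x ^ 2 < 1) :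
    ∃ M : Matrix (α ⊕ β) (α ⊕ β) ℝ, M.PosDef ∧ (∀ i, M i i = 1) ∧
      (∀ u v, R u v → M (Sum.inl u) (Sum.inr v) = x) ∧
      (∀ u v, R u v → M (Sum.inr v) (Sum.inl u) = x) ∧
      (1 - x ^ 2) ^ (Fintype.card α - 1) * (1 + ((Fintype.card α : ℝ) - 1) * x ^ 2) *
        ∏ v, ((1 - x ^ 2) / (1 + (d v - 1) * x ^ 2)) ≤ M.det := by
  have hp : 0 < 1 - x ^ 2 := by linarith
  obtain ⟨hA, hdet⟩ := aux_detA (α := α) x h1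
  set A : Matrix α α ℝ := (1 - x ^ 2) • (1 : Matrix α α ℝ) + (x ^ 2) • vecMulVec 1 (star 1)
    with hAdef
  have hd0 : ∀ v, 0 ≤ d v := fun v => by
    rw [hd]; exact Finset.sum_nonneg fun u _ => by split_ifs <;> norm_num
  have hq : ∀ v, 0 < 1 + (d v - 1) * x ^ 2 := fun v => by
    nlinarith [mul_nonneg (hd0 v) (sq_nonneg x)]
  set r : β → ℝ := fun v => (1 - x ^ 2) / (1 + (d v - 1) * x ^ 2) with hr
  have hrp : ∀ v, 0 < r v := fun v => div_pos hp (hq v)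
  set c : β → ℝ := fun v => x / (1 + (d v - 1) * x ^ 2) with hc
  set C : Matrix α β ℝ := Matrix.of fun u v => if R u v then c v else 0 with hC
  have hsum : ∀ v, ∑ u, C u v = d v * c v := fun v => by
    rw [hd, Finset.sum_mul]
    exact Finset.sum_congr rfl fun u _ => by simp [hC]
  have hAC : ∀ u v, (A * C) u v = (1 - x ^ 2) * C u v + x ^ 2 * (d v * c v) := by
    intro u v
    rw [hAdef, Matrix.add_mul, Matrix.smul_mul, Matrix.smul_mul, Matrix.one_mul]
    simp only [Matrix.add_apply, Matrix.smul_apply, smul_eq_mul, Matrix.mul_apply,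
      vecMulVec_apply, Pi.one_apply, star_one, one_mul, hsum]
  have hACR : ∀ u v, R u v → (A * C) u v = x := by
    intro u v h
    rw [hAC]
    have := (hq v).ne'
    have hcq : c v * (1 + (d v - 1) * x ^ 2) = x := div_mul_cancel₀ _ this
    simp only [hC, Matrix.of_apply, if_pos h]
    linear_combination hcq
  have hCAC : ∀ v, ((A * C)ᴴ * C) v v = d v * c v * x := by
    intro v
    rw [Matrix.mul_apply, ← hsum, Finset.sum_mul]
    refine Finset.sum_congr rfl fun u _ => ?_
    by_cases h : R u v
    · simp only [conjTranspose_apply, hACR u v h, star_trivial]; ring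
    · simp [hC, h]
  letI : Invertible A := hA.isUnit.invertible
  have hS : (diagonal r + (A * C)ᴴ * C) - (A * C)ᴴ * A⁻¹ * (A * C) = diagonal r := by
    have : (A * C)ᴴ * A⁻¹ * (A * C) = (A * C)ᴴ * C := by
      rw [Matrix.mul_assoc, ← Matrix.mul_assoc A⁻¹, Matrix.inv_mul_of_invertible,
        Matrix.one_mul]
    rw [this, add_sub_cancel_right]
  have hdetM : (fromBlocks A (A * C) (A * C)ᴴ (diagonal r + (A * C)ᴴ * C)).det
      = A.det * ∏ v, r v := by
    rw [det_fromBlocks₁₁, invOf_eq_nonsing_inv, hS, det_diagonal]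
  refine ⟨fromBlocks A (A * C) (A * C)ᴴ (diagonal r + (A * C)ᴴ * C), ?_, ?_, ?_, ?_, ?_⟩
  · have hps : (fromBlocks A (A * C) (A * C)ᴴ (diagonal r + (A * C)ᴴ * C)).PosSemidef := by
      rw [PosDef.fromBlocks₁₁ _ _ hA, hS]
      exact PosSemidef.diagonal fun v => (hrp v).le
    rw [hps.posDef_iff_isUnit, Matrix.isUnit_iff_isUnit_det, hdetM, isUnit_iff_ne_zero]
    exact mul_ne_zero hA.det_pos.ne' (Finset.prod_pos fun v _ => hrp v).ne'
  · rintro (u | v)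
    · simp [hAdef, vecMulVec_apply]
    · rw [fromBlocks_apply₂₂, Matrix.add_apply, hCAC, diagonal_apply_eq]
      have := (hq v).ne'
      have hcq : c v * (1 + (d v - 1) * x ^ 2) = x := div_mul_cancel₀ _ this
      have hrq : r v * (1 + (d v - 1) * x ^ 2) = 1 - x ^ 2 := div_mul_cancel₀ _ this
      apply mul_right_cancel₀ this
      linear_combination hrq + d v * x * hcq
  · intro u v h
    rw [fromBlocks_apply₁₂, hACR u v h]
  · intro u v h
    rw [fromBlocks_apply₂₁, conjTranspose_apply, hACR u v h, star_trivial]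
  · rw [hdetM]
    exact mul_le_mul_of_nonneg_right hdet (Finset.prod_nonneg fun v _ => (hrp v).le)


/-- For a bipartite graph `G` with classes `V₁, V₂` (`a = |V₁|`, degrees
`d_v` of vertices `v ∈ V₂`), the maximum determinant `τ(G,x)` over `Ψ(G,x)` is
at least `(1-x²)^{a+b-1} (1+(a-1)x²) ∏_{v∈V₂} (1+(d_v-1)x²)⁻¹`. -/
theorem tau_lower_bound_coupling {V : Type*} [Fintype V] [DecidableEq V]
    (G : SimpleGraph V) [DecidableRel G.Adj] (V₁ V₂ : Finset V)
    (hdisj : Disjoint V₁ V₂) (hcover : V₁ ∪ V₂ = Finset.univ)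
    (hbip : ∀ i j, G.Adj i j → (i ∈ V₁ ∧ j ∈ V₂) ∨ (i ∈ V₂ ∧ j ∈ V₁))
    (hdeg : ∀ v ∈ V₂, 1 ≤ G.degree v)
    (x : ℝ) (hx : x ∈ Set.Ioo (-1 : ℝ) 1) :
    ∃ M ∈ Psi G x,
      (1 - x ^ 2) ^ (V₁.card + V₂.card - 1) * (1 + ((V₁.card : ℝ) - 1) * x ^ 2) *
        (∏ v ∈ V₂, (1 + ((G.degree v : ℝ) - 1) * x ^ 2))⁻¹ ≤ M.det := by
  have h1 : x ^ 2 < 1 := by nlinarith [hx.1, hx.2]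
  have hp : 0 < 1 - x ^ 2 := by linarith
  have hmem : ∀ v, v ∉ V₁ ↔ v ∈ V₂ := by
    intro v
    have hv : v ∈ V₁ ∪ V₂ := hcover ▸ Finset.mem_univ v
    rw [Finset.mem_union] at hv
    exact ⟨fun h => hv.resolve_left h, fun h h' => Finset.disjoint_left.1 hdisj h' h⟩
  obtain ⟨M, hM, hM1, hM2, hM3, hM4⟩ := aux_block
    (α := {v // v ∈ V₁}) (β := {v // ¬ v ∈ V₁}) (fun u v => G.Adj u.1 v.1)
    (fun v => (G.degree v.1 : ℝ)) (by
      intro v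
      have h0 : ∑ u : {v // v ∈ V₁}, (if G.Adj u.1 v.1 then (1 : ℝ) else 0)
          = ∑ u ∈ V₁, (if G.Adj u v.1 then (1 : ℝ) else 0) :=
        Finset.sum_coe_sort V₁ (fun u => if G.Adj u v.1 then (1 : ℝ) else 0)
      rw [h0, Finset.sum_boole]
      congr 1
      rw [← SimpleGraph.card_neighborFinset_eq_degree]
      congr 1
      ext w
      simp only [SimpleGraph.mem_neighborFinset, Finset.mem_filter]
      constructor
      · intro h
        refine ⟨?_, h.symm⟩
        rcases hbip _ _ h with h' | h'
        · exact absurd h'.1 v.2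
        · exact h'.2
      · exact fun h => h.2.symm) x h1
  let e := (Equiv.sumCompl (fun v => v ∈ V₁)).symm
  have e1 : ∀ v (h : v ∈ V₁), e v = Sum.inl ⟨v, h⟩ := fun v h =>
    Equiv.sumCompl_symm_apply_of_pos h
  have e2 : ∀ v (h : v ∉ V₁), e v = Sum.inr ⟨v, h⟩ := fun v h =>
    Equiv.sumCompl_symm_apply_of_neg h
  refine ⟨M.submatrix e e, ⟨hM.submatrix e.injective, fun i => hM1 _, ?_⟩, ?_⟩
  · intro i j hij
    rw [Matrix.submatrix_apply]
    rcases hbip i j hij with ⟨hi, hj⟩ | ⟨hi, hj⟩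
    · rw [e1 i hi, e2 j ((hmem j).2 hj)]
      exact hM2 _ _ hij
    · rw [e1 j hj, e2 i ((hmem i).2 hi)]
      exact hM3 _ _ hij.symm
  · rw [Matrix.det_submatrix_equiv_self]
    refine le_trans (le_of_eq ?_) hM4
    have hprod : ∏ v : {v // ¬ v ∈ V₁}, ((1 - x ^ 2) / (1 + ((G.degree v.1 : ℝ) - 1) * x ^ 2))
        = ∏ v ∈ V₂, ((1 - x ^ 2) / (1 + ((G.degree v : ℝ) - 1) * x ^ 2)) :=
      (Finset.prod_subtype V₂ (fun v => (hmem v).symm)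
        (fun v => ((1 - x ^ 2) / (1 + ((G.degree v : ℝ) - 1) * x ^ 2)))).symm
    rw [hprod, Finset.prod_div_distrib, Finset.prod_const, Fintype.card_coe, div_eq_mul_inv]
    have hpow : V₁.card + V₂.card - 1 = (V₁.card - 1) + V₂.card := by
      rcases Nat.eq_zero_or_pos V₁.card with h | h
      · have hV1 : V₁ = ∅ := Finset.card_eq_zero.1 h
        have hV2 : V₂ = ∅ := by
          by_contra hne
          obtain ⟨v, hv⟩ := Finset.nonempty_iff_ne_empty.2 hne
          have := hdeg v hv
          obtain ⟨w, hw⟩ := (G.degree_pos_iff_exists_adj v).1 this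
          have := hbip v w hw
          rcases this with h' | h'
          · simp [hV1] at h'
          · simp [hV1] at h'
        simp [hV1, hV2]
      · omega
    rw [hpow, pow_add]
    ring
end

section
/- Let G be a bipartite graph with color classes V₁ and V₂ such that ∑_{v ∈ V₂} deg(v)(deg(v)-1) ≥ |V₁|(|V₁|-1). Then for every x ∈ (-1,1), τ(G,x) ≥ (1-x²)^{|E(G)|}, where τ(G,x) is the maximum determinant over the set Ψ(G,x) of positive definite symmetric matrices with unit diagonal and entries x on edges of G. -/
open scoped Matrix

/-- Key monotonicity of the logarithmic function. -/
lemma key_log (k m : ℕ) (hkm : k ≤ m) (y : ℝ) (hy0 : 0 ≤ y) (hy1 : y < 1) :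
    (m * (m + 1) : ℝ) * (k * Real.log (1 - y) + Real.log (1 + k * y)) ≤
      (k * (k + 1) : ℝ) * (m * Real.log (1 - y) + Real.log (1 + m * y)) := by
  have hkm' : (k : ℝ) ≤ m := by exact_mod_cast hkm
  have hk0 : (0 : ℝ) ≤ k := Nat.cast_nonneg k
  have hm0 : (0 : ℝ) ≤ m := Nat.cast_nonneg m
  have hder : ∀ (c s : ℝ), 0 ≤ c → 0 ≤ s → s < 1 →
      HasDerivAt (fun s : ℝ => c * Real.log (1 - s) + Real.log (1 + c * s))
        (-(c * (c + 1)) * (s / ((1 - s) * (1 + c * s)))) s := by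
    intro c s hc hs0 hs1
    have h1 : (1 - s) ≠ 0 := by linarith
    have h2 : (1 + c * s) ≠ 0 := by positivity
    have d1 : HasDerivAt (fun s : ℝ => 1 - s) (-1) s := by
      simpa using (hasDerivAt_id s).const_sub 1
    have d2 : HasDerivAt (fun s : ℝ => 1 + c * s) c s := by
      simpa using ((hasDerivAt_id s).const_mul c).const_add 1
    have := ((d1.log h1).const_mul c).add (d2.log h2)
    refine this.congr_deriv ?_
    field_simp
    ring
  set h : ℝ → ℝ := fun s =>
    (m * (m + 1) : ℝ) * (k * Real.log (1 - s) + Real.log (1 + k * s)) -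
      (k * (k + 1) : ℝ) * (m * Real.log (1 - s) + Real.log (1 + m * s)) with hh
  have hd : ∀ s : ℝ, 0 ≤ s → s < 1 → HasDerivAt h
      ((m * (m + 1) : ℝ) * (-(k * (k + 1)) * (s / ((1 - s) * (1 + k * s)))) -
        (k * (k + 1) : ℝ) * (-(m * (m + 1)) * (s / ((1 - s) * (1 + m * s))))) s := by
    intro s hs0 hs1
    exact ((hder k s hk0 hs0 hs1).const_mul _).sub ((hder m s hm0 hs0 hs1).const_mul _)
  have hanti : AntitoneOn h (Set.Icc 0 y) := by
    apply antitoneOn_of_deriv_nonpos (convex_Icc 0 y)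
    · intro s hs
      exact (hd s hs.1 (by linarith [hs.2])).continuousAt.continuousWithinAt
    · intro s hs
      rw [interior_Icc] at hs
      exact (hd s hs.1.le (by linarith [hs.2])).differentiableAt.differentiableWithinAt
    · intro s hs
      rw [interior_Icc] at hs
      have hs0 : 0 ≤ s := hs.1.le
      have hs1 : s < 1 := by linarith [hs.2]
      rw [(hd s hs0 hs1).deriv]
      have hle : s / ((1 - s) * (1 + m * s)) ≤ s / ((1 - s) * (1 + k * s)) := by
        have : 0 < 1 - s := by linarith
        gcongr
      have hc : (0 : ℝ) ≤ (m * (m + 1)) * (k * (k + 1)) := by positivity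
      nlinarith [mul_le_mul_of_nonneg_left hle hc]
  have := hanti (Set.left_mem_Icc.2 hy0) (Set.right_mem_Icc.2 hy0) hy0
  simp only [hh] at this
  simp at this
  linarith

lemma key_prod {V : Type*} (S : Finset V) (k : V → ℕ) (m : ℕ) (hk : ∀ v ∈ S, k v ≤ m)
    (hsum : m * (m + 1) ≤ ∑ v ∈ S, k v * (k v + 1)) (y : ℝ) (hy0 : 0 ≤ y) (hy1 : y < 1) :
    ∏ v ∈ S, ((1 - y) ^ k v * (1 + k v * y)) ≤ (1 - y) ^ m * (1 + m * y) := by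
  have ha : 0 < 1 - y := by linarith
  rcases Nat.eq_zero_or_pos m with rfl | hm
  · have : ∀ v ∈ S, ((1 - y) ^ k v * (1 + k v * y)) = 1 := by
      intro v hv
      have : k v = 0 := by have := hk v hv; omega
      simp [this]
    rw [Finset.prod_congr rfl this]
    simp
  have hpos : ∀ j : ℕ, 0 < (1 - y) ^ j * (1 + j * y) := fun j => by positivity
  have hlog : ∀ j : ℕ, Real.log ((1 - y) ^ j * (1 + j * y)) =
      j * Real.log (1 - y) + Real.log (1 + j * y) := by
    intro j
    rw [Real.log_mul (by positivity) (by positivity), Real.log_pow]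
  rw [← Real.log_le_log_iff (Finset.prod_pos fun v _ => hpos _) (hpos _),
    Real.log_prod (fun v _ => (hpos _).ne'), hlog]
  simp only [hlog]
  have hneg : m * Real.log (1 - y) + Real.log (1 + m * y) ≤ 0 := by
    have h1 := Real.log_le_sub_one_of_pos ha
    have h2 := Real.log_le_sub_one_of_pos (show 0 < 1 + m * y by positivity)
    have hm0 : (0 : ℝ) ≤ m := Nat.cast_nonneg m
    nlinarith [mul_le_mul_of_nonneg_left h1 hm0]
  have hmm : (0 : ℝ) < m * (m + 1) := by positivity
  have h1 := Finset.sum_le_sum fun v hv => key_log (k v) m (hk v hv) y hy0 hy1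
  rw [← Finset.mul_sum, ← Finset.sum_mul] at h1
  have h2 : (m * (m + 1) : ℝ) ≤ ∑ v ∈ S, (k v * (k v + 1) : ℝ) := by exact_mod_cast hsum
  have h3 := mul_le_mul_of_nonpos_right h2 hneg
  exact le_of_mul_le_mul_left (h1.trans h3) hmm

/-- If `G` is bipartite with classes `V₁, V₂` and
`∑_{v∈V₂} deg(v)(deg(v)-1) ≥ |V₁|(|V₁|-1)`, then `τ(G,x) ≥ (1-x²)^{|E(G)|}`
for every `x ∈ (-1,1)`. -/
theorem tau_ge_of_degree_condition {V : Type*} [Fintype V] [DecidableEq V]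
    (G : SimpleGraph V) [DecidableRel G.Adj] (V₁ V₂ : Finset V)
    (hdisj : Disjoint V₁ V₂) (hcover : V₁ ∪ V₂ = Finset.univ)
    (hbip : ∀ i j, G.Adj i j → (i ∈ V₁ ∧ j ∈ V₂) ∨ (i ∈ V₂ ∧ j ∈ V₁))
    (hdeg : ∀ v ∈ V₂, 1 ≤ G.degree v)
    (hsum : V₁.card * (V₁.card - 1) ≤ ∑ v ∈ V₂, G.degree v * (G.degree v - 1))
    (x : ℝ) (hx : x ∈ Set.Ioo (-1 : ℝ) 1) :
    ∃ M ∈ Psi G x, (1 - x ^ 2) ^ G.edgeFinset.card ≤ M.det := by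
  classical
  obtain ⟨y, hy⟩ : ∃ y, y = x ^ 2 := ⟨_, rfl⟩
  have hy0 : 0 ≤ y := by rw [hy]; positivity
  have hy1 : y < 1 := by rw [hy]; nlinarith [hx.1, hx.2]
  have ha : 0 < 1 - y := by linarith
  rw [← hy]
  have hmem : ∀ v, v ∉ V₁ ↔ v ∈ V₂ := by
    intro v
    have h1 : v ∈ V₁ ∪ V₂ := by rw [hcover]; exact Finset.mem_univ v
    rw [Finset.mem_union] at h1
    have h2 : v ∈ V₁ → v ∉ V₂ := fun h h' => Finset.disjoint_left.1 hdisj h h'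
    tauto
  have hadj2 : ∀ v ∈ V₂, ∀ i, G.Adj v i → i ∈ V₁ := by
    intro v hv i h
    rcases hbip v i h with h' | h'
    · exact absurd h'.1 ((hmem v).2 hv)
    · exact h'.2
  have hq : ∀ v ∈ V₂, 0 < 1 + ((G.degree v : ℝ) - 1) * y := by
    intro v hv
    have : (1 : ℝ) ≤ G.degree v := by exact_mod_cast hdeg v hv
    have : 0 ≤ ((G.degree v : ℝ) - 1) * y := mul_nonneg (by linarith) hy0
    linarith
  set q : V → ℝ := fun v => 1 + ((G.degree v : ℝ) - 1) * y with hqdef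
  set w : V → ℝ := fun v => if v ∈ V₁ then 1 - y else (1 - y) / q v with hw
  set u : V → ℝ := fun v => if v ∈ V₁ then 1 else 0 with hu
  set B : Matrix V V ℝ := fun v i => if v ∈ V₂ ∧ G.Adj v i then x / q v else 0 with hB
  set D : Matrix V V ℝ := Matrix.diagonal w + y • Matrix.vecMulVec u u with hD
  have hwpos : ∀ v, 0 < w v := by
    intro v
    simp only [hw]
    split_ifs with h
    · exact ha
    · exact div_pos ha (hq v ((hmem v).1 h))
  have hDpos : D.PosDef := by
    refine (Matrix.PosDef.diagonal hwpos).add_posSemidef ?_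
    have := (Matrix.posSemidef_vecMulVec_self_star u).smul hy0
    simpa using this
  have hBP : B * Matrix.diagonal u = B := by
    ext v i
    rw [Matrix.mul_diagonal]
    simp only [hB, hu]
    split_ifs with h1 h2 <;> simp
    exact absurd (hadj2 v h1.1 i h1.2) h2
  have hPB : Matrix.diagonal u * B = 0 := by
    ext v i
    rw [Matrix.diagonal_mul]
    simp only [hB, hu]
    split_ifs with h1 h2 <;> simp
    exact absurd h1 ((hmem v).2 h2.1)
  have hdetL : (1 + B).det = 1 := by
    rw [← hBP, Matrix.det_one_add_mul_comm, hPB]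
    simp
  have hdetD : D.det = (∏ v, w v) * (1 + y * (V₁.card / (1 - y))) := by
    have h1 : D = Matrix.diagonal w +
        Matrix.replicateCol Unit (y • u) * Matrix.replicateRow Unit u := by
      rw [hD]
      ext i j
      simp [Matrix.vecMulVec_apply, Matrix.mul_apply, mul_assoc]
    have hu1 : IsUnit (Matrix.diagonal w).det := by
      rw [Matrix.det_diagonal, isUnit_iff_ne_zero]
      exact (Finset.prod_pos fun v _ => hwpos v).ne'
    have hinv : (Matrix.diagonal w)⁻¹ = Matrix.diagonal (fun v => (w v)⁻¹) := by
      apply Matrix.inv_eq_right_inv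
      rw [Matrix.diagonal_mul_diagonal, ← Matrix.diagonal_one]
      congr 1
      ext v
      exact mul_inv_cancel₀ (hwpos v).ne'
    rw [h1, Matrix.det_add_replicateCol_mul_replicateRow hu1, Matrix.det_diagonal, hinv]
    congr 1
    have h2 : ∀ v, u v * (w v)⁻¹ * u v = if v ∈ V₁ then (1 - y)⁻¹ else 0 := by
      intro v
      simp only [hu, hw]
      split_ifs <;> simp
    have h3 : ∑ v, u v * (w v)⁻¹ * (y * u v) = y * (V₁.card / (1 - y)) := by
      have : ∀ v, u v * (w v)⁻¹ * (y * u v) = y * (if v ∈ V₁ then (1 - y)⁻¹ else 0) := by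
        intro v
        rw [← h2]; ring
      simp only [this, ← Finset.mul_sum]
      simp [div_eq_mul_inv]
    rw [← h3]
    simp [Matrix.mul_apply, Matrix.diagonal_apply]
    rw [Finset.mul_sum]
    exact Finset.sum_congr rfl fun v _ => by ring
  have hLunit : IsUnit (1 + B) := by
    rw [Matrix.isUnit_iff_isUnit_det, hdetL]; exact isUnit_one
  have hMapp : ∀ i j, ((1 + B) * D * (1 + B)ᵀ : Matrix V V ℝ) i j =
      (∑ k, w k * (1 + B) i k * (1 + B) j k) +
        y * ((1 + B).mulVec u i) * ((1 + B).mulVec u j) := by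
    intro i j
    have : (1 + B) * D * (1 + B)ᵀ = (1 + B) * Matrix.diagonal w * (1 + B)ᵀ +
        y • Matrix.vecMulVec ((1 + B).mulVec u) ((1 + B).mulVec u) := by
      rw [hD, Matrix.mul_add, Matrix.add_mul]
      congr 1
      rw [Matrix.mul_smul, Matrix.smul_mul, Matrix.mul_vecMulVec, Matrix.vecMulVec_mul,
        Matrix.vecMul_transpose]
    rw [this, Matrix.add_apply, Matrix.mul_apply]
    simp only [Matrix.mul_diagonal, Matrix.transpose_apply, Matrix.smul_apply,
      Matrix.vecMulVec_apply, smul_eq_mul]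
    congr 1
    · exact Finset.sum_congr rfl fun k _ => by ring
    · ring
  have hL1 : ∀ i ∈ V₁, ∀ k, (1 + B) i k = if i = k then 1 else 0 := by
    intro i hi k
    have : i ∉ V₂ := fun h => (hmem i).2 h hi
    rw [Matrix.add_apply, Matrix.one_apply]
    simp [hB, this]
  have hLu1 : ∀ i ∈ V₁, (1 + B).mulVec u i = 1 := by
    intro i hi
    simp only [Matrix.mulVec, dotProduct, hL1 i hi]
    simp [hu, hi]
  have hBsum : ∀ v ∈ V₂, ∀ (f : ℝ → ℝ), f 0 = 0 →
      ∑ k, f (B v k) = G.degree v * f (x / q v) := by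
    intro v hv f hf
    have : ∀ k, f (B v k) = if k ∈ G.neighborFinset v then f (x / q v) else 0 := by
      intro k
      simp only [hB, hv, true_and, SimpleGraph.mem_neighborFinset]
      split_ifs <;> simp [hf]
    simp only [this]
    rw [Finset.sum_ite_mem, Finset.univ_inter, Finset.sum_const, nsmul_eq_mul,
      G.card_neighborFinset_eq_degree]
  have hLu2 : ∀ v ∈ V₂, (1 + B).mulVec u v = G.degree v * (x / q v) := by
    intro v hv
    rw [Matrix.add_mulVec, Matrix.one_mulVec]
    have h0 : u v = 0 := by simp [hu, (hmem v).2 hv]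
    rw [Pi.add_apply, h0, zero_add]
    refine Eq.trans ?_ (hBsum v hv id rfl)
    simp only [Matrix.mulVec, dotProduct, id]
    refine Finset.sum_congr rfl fun k _ => ?_
    have := congrFun (congrFun hBP v) k
    rwa [Matrix.mul_diagonal] at this
  have hedge : ∀ v ∈ V₂, ∀ i, G.Adj v i → ((1 + B) * D * (1 + B)ᵀ : Matrix V V ℝ) v i = x := by
    intro v hv i hvi
    have hi := hadj2 v hv i hvi
    have hqv : 0 < q v := hq v hv
    rw [hMapp, hLu1 i hi, hLu2 v hv]
    simp only [hL1 i hi]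
    simp
    have : w i = 1 - y := by simp [hw, hi]
    rw [this, Matrix.one_apply_ne hvi.ne]
    have : B v i = x / q v := by simp [hB, hv, hvi]
    rw [this]
    field_simp
    simp only [hqdef]
    ring
  have hsymm : ((1 + B) * D * (1 + B)ᵀ).PosDef := by
    have := (Matrix.IsUnit.posDef_star_right_conjugate_iff (x := D) hLunit).2 hDpos
    simpa [Matrix.star_eq_conjTranspose] using this
  refine ⟨(1 + B) * D * (1 + B)ᵀ, ⟨hsymm, ?_, ?_⟩, ?_⟩
  · intro i
    by_cases hi : i ∈ V₁
    · rw [hMapp, hLu1 i hi]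
      simp only [hL1 i hi]
      simp [hw, hi]
    · have hv := (hmem i).1 hi
      have hqv : 0 < q i := hq i hv
      rw [hMapp, hLu2 i hv]
      have h1 : ∀ k, w k * (1 + B) i k * (1 + B) i k =
          (if i = k then w i else 0) + (1 - y) * (B i k) ^ 2 := by
        intro k
        rw [Matrix.add_apply, Matrix.one_apply]
        by_cases hik : i = k
        · subst hik
          simp [hB]
        · by_cases hA : G.Adj i k
          · have hk := hadj2 i hv k hA
            simp [hik, hw, hk]; ring
          · simp [hik, hB, hA]
      simp only [h1, Finset.sum_add_distrib, ← Finset.mul_sum]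
      rw [hBsum i hv (fun t => t ^ 2) (by simp)]
      have hwi : w i = (1 - y) / q i := by simp [hw, hi]
      simp only [Finset.sum_ite_eq, Finset.mem_univ, if_true, hwi]
      have e : (1 - y) / q i + (1 - y) * (G.degree i * (x / q i) ^ 2) +
          y * (G.degree i * (x / q i)) * (G.degree i * (x / q i)) =
          ((1 - y) * q i + y * G.degree i * ((1 - y) + y * G.degree i)) / q i ^ 2 := by
        field_simp
        rw [← hy]
        ring
      rw [e, div_eq_one_iff_eq (by positivity)]
      simp only [hqdef]
      ring
  · intro i j hij
    rcases hbip i j hij with h | h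
    · have := hsymm.isHermitian.apply i j
      rw [← this, hedge j h.2 i hij.symm]
      simp
    · exact hedge i h.1 j hij
  · rw [Matrix.det_mul, Matrix.det_mul, Matrix.det_transpose, hdetL, hdetD, one_mul, mul_one]
    have hE : G.edgeFinset.card = ∑ v ∈ V₂, G.degree v := by
      have hb : G.IsBipartiteWith (V₁ : Set V) (V₂ : Set V) :=
        ⟨Finset.disjoint_coe.2 hdisj, fun i j h => by simpa using hbip i j h⟩
      exact (SimpleGraph.isBipartiteWith_sum_degrees_eq_card_edges' hb).symm
    have hprod : ∏ v, w v = (1 - y) ^ V₁.card * ∏ v ∈ V₂, ((1 - y) / q v) := by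
      rw [← hcover, Finset.prod_union hdisj]
      congr 1
      · rw [← Finset.prod_const]
        exact Finset.prod_congr rfl fun v hv => by simp [hw, hv]
      · exact Finset.prod_congr rfl fun v hv => by simp [hw, (hmem v).2 hv]
    rw [hE, hprod, ← Finset.prod_pow_eq_pow_sum]
    have hdle : ∀ v ∈ V₂, G.degree v ≤ V₁.card := by
      intro v hv
      rw [← G.card_neighborFinset_eq_degree]
      exact Finset.card_le_card fun i hi => hadj2 v hv i (by simpa using hi)
    rcases Nat.eq_zero_or_pos V₁.card with hn | hn
    · have : V₂ = ∅ := by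
        rw [Finset.eq_empty_iff_forall_notMem]
        intro v hv
        have := hdle v hv
        have := hdeg v hv
        omega
      simp [this, hn]
    · obtain ⟨m, hm⟩ : ∃ m, V₁.card = m + 1 := ⟨V₁.card - 1, by omega⟩
      have hs' : m * (m + 1) ≤ ∑ v ∈ V₂, (G.degree v - 1) * (G.degree v - 1 + 1) := by
        rw [hm] at hsum
        calc m * (m + 1) = (m + 1) * (m + 1 - 1) := by simp [mul_comm]
          _ ≤ _ := hsum
          _ = _ := Finset.sum_congr rfl fun v hv => by
            rw [Nat.sub_add_cancel (hdeg v hv), mul_comm]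
      have hk := key_prod V₂ (fun v => G.degree v - 1) m
        (fun v hv => by have := hdle v hv; omega) hs' y hy0 hy1
      have hl : ∏ v ∈ V₂, (1 - y) ^ G.degree v =
          (∏ v ∈ V₂, ((1 - y) ^ (G.degree v - 1) * (1 + ((G.degree v - 1 : ℕ) : ℝ) * y))) *
            ∏ v ∈ V₂, ((1 - y) / q v) := by
        rw [← Finset.prod_mul_distrib]
        refine Finset.prod_congr rfl fun v hv => ?_
        have hqv : 0 < q v := hq v hv
        have : 1 + ((G.degree v - 1 : ℕ) : ℝ) * y = q v := by
          rw [Nat.cast_sub (hdeg v hv)]; simp [hqdef]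
        rw [this]
        conv_lhs => rw [← Nat.sub_add_cancel (hdeg v hv), pow_succ]
        field_simp
      rw [hl]
      have hr : (1 - y) ^ V₁.card * (∏ v ∈ V₂, ((1 - y) / q v)) *
          (1 + y * (V₁.card / (1 - y))) =
          ((1 - y) ^ m * (1 + m * y)) * ∏ v ∈ V₂, ((1 - y) / q v) := by
        rw [hm, pow_succ]
        push_cast
        field_simp
        ring
      rw [hr]
      exact mul_le_mul_of_nonneg_right hk
        (Finset.prod_nonneg fun v hv => (div_pos ha (hq v hv)).le)
end
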